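/- Fix d ∈ ℂ and define K(d, λ) = Σ_{k=1}^∞ (d − λᵏ)·conj(d − λᵏ) / k² for λ in the open unit disk 𝔻. Then for λ ∈ 𝔻 with λ ≠ 0, the mixed Wirtinger derivative satisfies ∂_d ∂̄_λ K = Log(1 − λ̄) / λ̄, where Log is the principal branch of the complex logarithm; equivalently, ∂_d ∂̄_λ K = −Σ_{k=1}^∞ λ̄^{k−1}/k. -/

import Mathlib

/-- The Wirtinger derivative `∂_d = ½(∂/∂x − i ∂/∂y)` in the first variable of a
function on `ℂ × ℂ`. -/
noncomputable def wirtD (F : ℂ × ℂ → ℂ) (x : ℂ × ℂ) : ℂ :=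
  (fderiv ℝ F x (1, 0) - Complex.I * fderiv ℝ F x (Complex.I, 0)) / 2

/-- The conjugate Wirtinger derivative `∂̄_λ = ½(∂/∂x + i ∂/∂y)` in the second
variable of a function on `ℂ × ℂ`. -/
noncomputable def wirtBarL (F : ℂ × ℂ → ℂ) (x : ℂ × ℂ) : ℂ :=
  (fderiv ℝ F x (0, 1) + Complex.I * fderiv ℝ F x (0, Complex.I)) / 2

/-- The dilogarithm series `∑_{k≥1} z^k / k²`. -/
noncomputable def dilog (z : ℂ) : ℂ := ∑' k : ℕ, z ^ (k + 1) / ((k : ℂ) + 1) ^ 2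

theorem summable_one_div_succ_sq : Summable fun k : ℕ => 1 / ((k : ℝ) + 1) ^ 2 := by
  have h := (summable_nat_add_iff 1).2 (Real.summable_one_div_nat_pow.2 one_lt_two)
  simpa using h

theorem norm_dilog_term_le (k : ℕ) {z : ℂ} (hz : ‖z‖ ≤ 1) :
    ‖z ^ (k + 1) / ((k : ℂ) + 1) ^ 2‖ ≤ 1 / ((k : ℝ) + 1) ^ 2 := by
  have hk : ‖(k : ℂ) + 1‖ = (k : ℝ) + 1 := by
    exact_mod_cast Complex.norm_natCast (k + 1)
  rw [norm_div, norm_pow, norm_pow, hk]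
  gcongr
  exact pow_le_one₀ (norm_nonneg z) hz

theorem hasSum_dilog {z : ℂ} (hz : ‖z‖ ≤ 1) :
    HasSum (fun k : ℕ => z ^ (k + 1) / ((k : ℂ) + 1) ^ 2) (dilog z) :=
  (summable_one_div_succ_sq.of_norm_bounded fun k => norm_dilog_term_le k hz).hasSum

theorem differentiableOn_dilog : DifferentiableOn ℂ dilog (Metric.ball 0 1) :=
  Complex.differentiableOn_tsum_of_summable_norm summable_one_div_succ_sq
    (fun k => by fun_prop) Metric.isOpen_ball
    fun k _ hz => norm_dilog_term_le k (mem_ball_zero_iff.1 hz).le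

theorem hasDerivAt_dilog {z : ℂ} (hz : ‖z‖ < 1) : HasDerivAt dilog (deriv dilog z) z :=
  (differentiableOn_dilog.differentiableAt
    (Metric.isOpen_ball.mem_nhds (mem_ball_zero_iff.2 hz))).hasDerivAt

theorem hasDerivAt_deriv_dilog {z : ℂ} (hz : ‖z‖ < 1) :
    HasDerivAt (deriv dilog) (deriv (deriv dilog) z) z :=
  ((differentiableOn_dilog.deriv Metric.isOpen_ball).differentiableAt
    (Metric.isOpen_ball.mem_nhds (mem_ball_zero_iff.2 hz))).hasDerivAt

theorem hasSum_deriv_dilog {z : ℂ} (hz : ‖z‖ < 1) :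
    HasSum (fun k : ℕ => z ^ k / ((k : ℂ) + 1)) (deriv dilog z) := by
  have h := Complex.hasSum_deriv_of_summable_norm summable_one_div_succ_sq
    (F := fun (k : ℕ) (z : ℂ) => z ^ (k + 1) / ((k : ℂ) + 1) ^ 2)
    (fun k => by fun_prop) Metric.isOpen_ball
    (fun k _ hz => norm_dilog_term_le k (mem_ball_zero_iff.1 hz).le) (mem_ball_zero_iff.2 hz)
  refine h.congr_fun fun k => ?_
  have hk : (k : ℂ) + 1 ≠ 0 := Nat.cast_add_one_ne_zero k
  simp
  field_simp

theorem deriv_dilog_eq_log {z : ℂ} (hz : ‖z‖ < 1) (h0 : z ≠ 0) :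
    deriv dilog z = -(Complex.log (1 - z) / z) := by
  have h := (hasSum_nat_add_iff' 1).2 (Complex.hasSum_taylorSeries_neg_log hz)
  have h' := (hasSum_deriv_dilog hz).mul_left z
  have e := h'.unique (h.congr_fun fun k => by push_cast; ring)
  simp only [Finset.range_one, Finset.sum_singleton, pow_zero, Nat.cast_zero, div_zero,
    sub_zero] at e
  field_simp
  linear_combination e

theorem norm_mul_conj_lt_one {z : ℂ} (hz : ‖z‖ < 1) : ‖z * starRingEnd ℂ z‖ < 1 := by
  rw [norm_mul, RCLike.norm_conj]
  nlinarith [norm_nonneg z]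

open ComplexConjugate in
theorem hasSum_kahlerPotential (x : ℂ × ℂ) (hx : ‖x.2‖ < 1) :
    HasSum (fun k : ℕ => (x.1 - x.2 ^ (k + 1)) * conj (x.1 - x.2 ^ (k + 1)) / ((k : ℂ) + 1) ^ 2)
      (x.1 * conj x.1 * dilog 1 - x.1 * conj (dilog x.2) - conj x.1 * dilog x.2 +
        dilog (x.2 * conj x.2)) := by
  have h1 := (hasSum_dilog (z := 1) (by simp)).mul_left (x.1 * conj x.1)
  have h2 := (Complex.hasSum_conj'.2 (hasSum_dilog hx.le)).mul_left x.1
  have h3 := (hasSum_dilog hx.le).mul_left (conj x.1)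
  refine (((h1.sub h2).sub h3).add (hasSum_dilog (norm_mul_conj_lt_one hx).le)).congr_fun ?_
  intro k
  simp
  ring

theorem HasFDerivAt.wirtD_eq {F : ℂ × ℂ → ℂ} {F' : ℂ × ℂ →L[ℝ] ℂ} {x : ℂ × ℂ}
    (h : HasFDerivAt F F' x) : wirtD F x = (F' (1, 0) - Complex.I * F' (Complex.I, 0)) / 2 := by
  rw [wirtD, h.fderiv]

theorem HasFDerivAt.wirtBarL_eq {F : ℂ × ℂ → ℂ} {F' : ℂ × ℂ →L[ℝ] ℂ} {x : ℂ × ℂ}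
    (h : HasFDerivAt F F' x) : wirtBarL F x = (F' (0, 1) + Complex.I * F' (0, Complex.I)) / 2 := by
  rw [wirtBarL, h.fderiv]

open ComplexConjugate in
theorem wirtBarL_of_hasDerivAt {P : ℂ → ℂ} {p q c : ℂ} {x : ℂ × ℂ} (hp : HasDerivAt P p x.2)
    (hq : HasDerivAt P q (x.2 * conj x.2)) :
    wirtBarL (fun y => y.1 * conj y.1 * c - y.1 * conj (P y.2) - conj y.1 * P y.2 +
      P (y.2 * conj y.2)) x = -(x.1 * conj p) + q * x.2 := by
  have h1 : HasFDerivAt (𝕜 := ℝ) (fun y : ℂ × ℂ => y.1) (.fst ℝ ℂ ℂ) x := hasFDerivAt_fst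
  have h2 : HasFDerivAt (𝕜 := ℝ) (fun y : ℂ × ℂ => y.2) (.snd ℝ ℂ ℂ) x := hasFDerivAt_snd
  have c1 := h1.star
  have c2 := h2.star
  have hP := hp.complexToReal_fderiv.comp x h2
  have hQ := HasFDerivAt.comp x (f := fun y : ℂ × ℂ => y.2 * conj y.2) hq.complexToReal_fderiv
    (h2.mul c2)
  have h := ((((h1.mul c1).mul_const c).sub (h1.mul hP.star)).sub (c1.mul hP)).add hQ
  refine h.wirtBarL_eq.trans ?_
  simp
  linear_combination (x.1 * conj p - q * x.2 - conj x.1 * p + q * conj x.2) / 2 * Complex.I_sq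

open ComplexConjugate in
theorem wirtD_of_hasDerivAt {R : ℂ → ℂ} {p q : ℂ} {x : ℂ × ℂ} (hp : HasDerivAt R p x.2)
    (hq : HasDerivAt R q (x.2 * conj x.2)) :
    wirtD (fun y => -(y.1 * conj (R y.2)) + R (y.2 * conj y.2) * y.2) x = -conj (R x.2) := by
  have h1 : HasFDerivAt (𝕜 := ℝ) (fun y : ℂ × ℂ => y.1) (.fst ℝ ℂ ℂ) x := hasFDerivAt_fst
  have h2 : HasFDerivAt (𝕜 := ℝ) (fun y : ℂ × ℂ => y.2) (.snd ℝ ℂ ℂ) x := hasFDerivAt_snd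
  have hP := hp.complexToReal_fderiv.comp x h2
  have hQ := HasFDerivAt.comp x (f := fun y : ℂ × ℂ => y.2 * conj y.2) hq.complexToReal_fderiv
    (h2.mul h2.star)
  have h := (h1.mul hP.star).neg.add (hQ.mul h2)
  refine h.wirtD_eq.trans ?_
  simp
  linear_combination conj (R x.2) / 2 * Complex.I_sq

theorem eventually_norm_snd_lt_one {x : ℂ × ℂ} (hx : ‖x.2‖ < 1) :
    ∀ᶠ y : ℂ × ℂ in nhds x, ‖y.2‖ < 1 :=
  (continuous_snd.norm.tendsto x).eventually (gt_mem_nhds hx)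

theorem wirtBarL_congr {F G : ℂ × ℂ → ℂ} {x : ℂ × ℂ} (h : F =ᶠ[nhds x] G) :
    wirtBarL F x = wirtBarL G x := by
  rw [wirtBarL, wirtBarL, h.fderiv_eq]

theorem wirtD_congr {F G : ℂ × ℂ → ℂ} {x : ℂ × ℂ} (h : F =ᶠ[nhds x] G) :
    wirtD F x = wirtD G x := by
  rw [wirtD, wirtD, h.fderiv_eq]

/-- For the ARFIMA(1,d,0) Kähler potential
`K(d,λ) = Σ_{k≥1} (d − λᵏ)·conj(d − λᵏ)/k²`, the mixed Wirtinger derivative at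
`λ ∈ 𝔻 \ {0}` is `∂_d ∂̄_λ K = Log(1 − λ̄)/λ̄ = −Σ_{k≥1} λ̄^{k−1}/k`, encoding the
metric component `g_{dλ̄}`. -/
theorem stmt17 (d : ℂ) :
    let K : ℂ × ℂ → ℂ := fun x =>
      ∑' k : ℕ,
        (x.1 - x.2 ^ (k + 1)) * starRingEnd ℂ (x.1 - x.2 ^ (k + 1)) / ((k : ℂ) + 1) ^ 2
    ∀ l : ℂ, ‖l‖ < 1 → l ≠ 0 →
      wirtD (fun x => wirtBarL K x) (d, l)
          = Complex.log (1 - starRingEnd ℂ l) / starRingEnd ℂ l ∧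
      wirtD (fun x => wirtBarL K x) (d, l)
          = -∑' k : ℕ, (starRingEnd ℂ l) ^ k / ((k : ℂ) + 1) := by
  intro K l hl h0
  have hbar : ∀ x : ℂ × ℂ, ‖x.2‖ < 1 → wirtBarL K x =
      -(x.1 * starRingEnd ℂ (deriv dilog x.2)) +
        deriv dilog (x.2 * starRingEnd ℂ x.2) * x.2 := fun x hx => by
    rw [← wirtBarL_of_hasDerivAt (c := dilog 1) (hasDerivAt_dilog hx)
      (hasDerivAt_dilog (norm_mul_conj_lt_one hx))]
    refine wirtBarL_congr ?_
    filter_upwards [eventually_norm_snd_lt_one hx] with y hy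
    exact (hasSum_kahlerPotential y hy).tsum_eq
  have hmain : wirtD (fun x => wirtBarL K x) (d, l) = -deriv dilog (starRingEnd ℂ l) := by
    have hconj : starRingEnd ℂ (deriv dilog l) = deriv dilog (starRingEnd ℂ l) := by
      refine (Complex.hasSum_conj'.2 (hasSum_deriv_dilog hl)).unique ?_
      convert hasSum_deriv_dilog (z := starRingEnd ℂ l) (by simpa using hl) using 2 with k
      simp
    rw [← hconj, ← wirtD_of_hasDerivAt (x := (d, l)) (hasDerivAt_deriv_dilog hl)
      (hasDerivAt_deriv_dilog (norm_mul_conj_lt_one hl))]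
    refine wirtD_congr ?_
    filter_upwards [eventually_norm_snd_lt_one (x := (d, l)) hl] with y hy
    exact hbar y hy
  have hl' : ‖starRingEnd ℂ l‖ < 1 := by simpa using hl
  refine ⟨?_, ?_⟩
  · rw [hmain, deriv_dilog_eq_log hl' (by simpa using h0), neg_neg]
  · rw [hmain, (hasSum_deriv_dilog hl').tsum_eq]
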